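/- Let ⟨E,⊢⟩ be a pure event structure and let x, y ∈ L(⟨E,⊢⟩) be left-closed configurations. Then x →_E y (i.e. x ⊆ y and for every Z ⊆ y there exists W ⊆ x with W ⊢ Z) if and only if x ⊆ y and every Z with x ⊆ Z ⊆ y lies in L(⟨E,⊢⟩). -/

import Mathlib

/-- The left-closed configurations of an event structure `⟨E,⊢⟩`. -/
def LeftClosed {E : Type*} (en : Set E → Set E → Prop) : Set (Set E) :=
  {X | ∀ Y ⊆ X, ∃ Z ⊆ X, en Z Y}

/-- An event structure is pure if `X ⊢ Y` implies `X ∩ Y = ∅`. -/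
def PureES {E : Type*} (en : Set E → Set E → Prop) : Prop :=
  ∀ X Y, en X Y → X ∩ Y = ∅

/-- For a pure event structure and left-closed configurations `x, y`,
the step transition `x →_E y` holds iff `x ⊆ y` and every `Z` with
`x ⊆ Z ⊆ y` is a left-closed configuration. -/
theorem stmt_5 {E : Type*} (en : Set E → Set E → Prop) (hpure : PureES en)
    {x y : Set E} (hx : x ∈ LeftClosed en) (hy : y ∈ LeftClosed en) :
    (x ⊆ y ∧ ∀ Z ⊆ y, ∃ W ⊆ x, en W Z) ↔
    (x ⊆ y ∧ ∀ Z, x ⊆ Z → Z ⊆ y → Z ∈ LeftClosed en) := by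
  constructor
  · rintro ⟨hxy, h⟩
    refine ⟨hxy, fun Z hxZ hZy Y hY => ?_⟩
    obtain ⟨W, hW, hen⟩ := h Y (hY.trans hZy)
    exact ⟨W, hW.trans hxZ, hen⟩
  · rintro ⟨hxy, h⟩
    refine ⟨hxy, fun Z hZ => ?_⟩
    obtain ⟨W, hW, hen⟩ := h (x ∪ Z) Set.subset_union_left
      (Set.union_subset hxy hZ) Z Set.subset_union_right
    refine ⟨W, fun e he => ?_, hen⟩
    rcases hW he with h1 | h1
    · exact h1
    · have h2 : e ∈ W ∩ Z := ⟨he, h1⟩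
      rw [hpure W Z hen] at h2
      exact h2.elim
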